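/- For all integers t ≥ 0 and every t-restricted 0/1 matrix A indexed by [m]×[n], there is a t-restricted 0/1 matrix B indexed by [m]×[n] with breadth at most 4t such that the local difference between A and B is at most 4t. -/

import Mathlib

/-- A subset `F` of `[m] × [n]` is up-closed if whenever `(i,j) ∈ F`, `i ≤ i'` and `j ≤ j'`,
we have `(i',j') ∈ F`. -/
def UpClosed {m n : ℕ} (F : Set (Fin m × Fin n)) : Prop :=
  ∀ i i' : Fin m, ∀ j j' : Fin n, i ≤ i' → j ≤ j' → (i, j) ∈ F → (i', j') ∈ F

/-- A subset `F` of `[m] × [n]` is down-closed if its complement is up-closed. -/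
def DownClosed {m n : ℕ} (F : Set (Fin m × Fin n)) : Prop :=
  UpClosed Fᶜ

/-- The maximal down-closed subset of `E`. -/
def maxDownClosedIn {m n : ℕ} (E : Set (Fin m × Fin n)) : Set (Fin m × Fin n) :=
  ⋃₀ {F : Set (Fin m × Fin n) | DownClosed F ∧ F ⊆ E}

/-- The maximal up-closed subset of `E`. -/
def maxUpClosedIn {m n : ℕ} (E : Set (Fin m × Fin n)) : Set (Fin m × Fin n) :=
  ⋃₀ {F : Set (Fin m × Fin n) | UpClosed F ∧ F ⊆ E}

/-- The breadth of `A` is at most `w`: every diagonal of `A` (the pairs `(i,j)` with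
`j = i + c` avoiding the maximal down-closed subset `X` of the zero set and the maximal
up-closed subset `Y` of the support) has cardinality at most `w`. -/
def BreadthLE {m n : ℕ} (A : Fin m → Fin n → Bool) (w : ℕ) : Prop :=
  ∀ c : ℤ,
    {p : Fin m × Fin n | ((p.2 : ℕ) : ℤ) = ((p.1 : ℕ) : ℤ) + c ∧
      p ∉ maxDownClosedIn {q : Fin m × Fin n | A q.1 q.2 = false} ∪
          maxUpClosedIn {q : Fin m × Fin n | A q.1 q.2 = true}}.ncard ≤ w

/-- A 0/1 matrix is `t`-restricted if for all `i < i'` at most `t` columns `j` have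
`a_{ij} = 1` and `a_{i'j} = 0`, and for all `j < j'` at most `t` rows `i` have
`a_{ij} = 1` and `a_{ij'} = 0`. -/
def TRestricted {m n : ℕ} (t : ℕ) (A : Fin m → Fin n → Bool) : Prop :=
  (∀ i i' : Fin m, i < i' →
    {j : Fin n | A i j = true ∧ A i' j = false}.ncard ≤ t) ∧
  (∀ j j' : Fin n, j < j' →
    {i : Fin m | A i j = true ∧ A i j' = false}.ncard ≤ t)

/-- The local difference between two 0/1 matrices is at most `d`: in every row and in every
column, they differ in at most `d` entries. -/
def MatLocalDiffLE {m n : ℕ} (A B : Fin m → Fin n → Bool) (d : ℕ) : Prop :=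
  (∀ i : Fin m, {j : Fin n | A i j ≠ B i j}.ncard ≤ d) ∧
  (∀ j : Fin n, {i : Fin m | A i j ≠ B i j}.ncard ≤ d)

open Finset in
theorem TRestricted.card_row_le {m n t : ℕ} {A : Fin m → Fin n → Bool} (hA : TRestricted t A)
    {i i' : Fin m} (h : i ≤ i') (C : Finset (Fin n)) :
    #{j ∈ C | A i j = true ∧ A i' j = false} ≤ t := by
  rcases h.eq_or_lt with rfl | h
  · simp
  · refine le_trans ?_ (hA.1 i i' h)
    rw [← Set.ncard_coe_finset]
    exact Set.ncard_le_ncard (fun j hj => by simpa using (mem_filter.1 hj).2) (Set.toFinite _)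

theorem TRestricted.transpose {m n t : ℕ} {A : Fin m → Fin n → Bool} (hA : TRestricted t A) :
    TRestricted t (fun j i => A i j) :=
  ⟨hA.2, hA.1⟩

open Finset in
theorem TRestricted.card_col_le {m n t : ℕ} {A : Fin m → Fin n → Bool} (hA : TRestricted t A)
    {j j' : Fin n} (h : j ≤ j') (R : Finset (Fin m)) :
    #{i ∈ R | A i j = true ∧ A i j' = false} ≤ t :=
  hA.transpose.card_row_le h R

open Finset in
/-- If row `a` is all ones on `C`, then every later row has at least `t + 1` ones on `C`. -/
theorem TRestricted.lt_card_ones {m n t : ℕ} {A : Fin m → Fin n → Bool} (hA : TRestricted t A)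
    {a i : Fin m} (h : a ≤ i) {C : Finset (Fin n)} (hC : #C = 2 * t + 1)
    (h1 : ∀ c ∈ C, A a c = true) : t < #{c ∈ C | A i c = true} := by
  have key := hA.card_row_le h C
  have hle : #{c ∈ C | ¬ A i c = true} ≤ #{c ∈ C | A a c = true ∧ A i c = false} :=
    card_le_card fun c hc => by
      obtain ⟨hc, hi⟩ := mem_filter.1 hc
      exact mem_filter.2 ⟨hc, h1 c hc, by simpa using hi⟩
  have := card_filter_add_card_filter_not (s := C) (fun c => A i c = true)
  omega

open Finset in
/-- If row `a'` is all zeros on `D`, then every earlier row has at least `t + 1` zeros on `D`. -/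
theorem TRestricted.lt_card_zeros {m n t : ℕ} {A : Fin m → Fin n → Bool} (hA : TRestricted t A)
    {i a' : Fin m} (h : i ≤ a') {D : Finset (Fin n)} (hD : #D = 2 * t + 1)
    (h0 : ∀ d ∈ D, A a' d = false) : t < #{d ∈ D | A i d = false} := by
  have key := hA.card_row_le h D
  have hle : #{d ∈ D | ¬ A i d = false} ≤ #{d ∈ D | A i d = true ∧ A a' d = false} :=
    card_le_card fun d hd => by
      obtain ⟨hd, hi⟩ := mem_filter.1 hd
      exact mem_filter.2 ⟨hd, by simpa using hi, h0 d hd⟩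
  have := card_filter_add_card_filter_not (s := D) (fun d => A i d = false)
  omega

open Finset in
theorem TRestricted.card_rows_between_le {m n t : ℕ} {A : Fin m → Fin n → Bool}
    (hA : TRestricted t A) {a a' : Fin m} {C D : Finset (Fin n)} {R : Finset (Fin m)}
    (hR : ∀ i ∈ R, a ≤ i ∧ i ≤ a') (hCD : ∀ c ∈ C, ∀ d ∈ D, c ≤ d)
    (hC : #C = 2 * t + 1) (hD : #D = 2 * t + 1)
    (h1 : ∀ c ∈ C, A a c = true) (h0 : ∀ d ∈ D, A a' d = false) : #R ≤ 4 * t := by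
  have hsum := sum_card_bipartiteAbove_eq_sum_card_bipartiteBelow (s := R) (t := C ×ˢ D)
    (fun i p => A i p.1 = true ∧ A i p.2 = false)
  have hlow : #R * ((t + 1) * (t + 1)) ≤ ∑ i ∈ R, #((C ×ˢ D).bipartiteAbove
      (fun i p => A i p.1 = true ∧ A i p.2 = false) i) := by
    rw [← smul_eq_mul]
    refine card_nsmul_le_sum _ _ _ fun i hi => ?_
    rw [bipartiteAbove, filter_product (fun c => A i c = true) (fun d => A i d = false),
      card_product]
    exact Nat.mul_le_mul (hA.lt_card_ones (hR i hi).1 hC h1)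
      (hA.lt_card_zeros (hR i hi).2 hD h0)
  have hup : ∑ p ∈ C ×ˢ D, #(R.bipartiteBelow
      (fun i p => A i p.1 = true ∧ A i p.2 = false) p) ≤ #(C ×ˢ D) * t := by
    rw [← smul_eq_mul]
    refine sum_le_card_nsmul _ _ _ fun p hp => ?_
    obtain ⟨hc, hd⟩ := mem_product.1 hp
    exact hA.card_col_le (hCD _ hc _ hd) R
  rw [card_product, hC, hD] at hup
  by_contra! h
  have : (4 * t + 1) * ((t + 1) * (t + 1)) ≤ #R * ((t + 1) * (t + 1)) :=
    Nat.mul_le_mul_right _ h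
  nlinarith

open Finset in
theorem TRestricted.not_row_ones_col_zeros {m n t : ℕ} {A : Fin m → Fin n → Bool}
    (hA : TRestricted t A) {a : Fin m} {b : Fin n} {C : Finset (Fin n)} {R : Finset (Fin m)}
    (hR : ∀ i ∈ R, a ≤ i) (hCb : ∀ c ∈ C, c ≤ b)
    (hC : #C = 2 * t + 1) (hRcard : #R = 2 * t + 1)
    (h1 : ∀ c ∈ C, A a c = true) (h0 : ∀ i ∈ R, A i b = false) : False := by
  have hsum := sum_card_bipartiteAbove_eq_sum_card_bipartiteBelow (s := R) (t := C)
    (fun i c => A i c = true)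
  have hlow : #R * (t + 1) ≤ ∑ i ∈ R, #(C.bipartiteAbove (fun i c => A i c = true) i) := by
    rw [← smul_eq_mul]
    exact card_nsmul_le_sum _ _ _ fun i hi => hA.lt_card_ones (hR i hi) hC h1
  have hup : ∑ c ∈ C, #(R.bipartiteBelow (fun i c => A i c = true) c) ≤ #C * t := by
    rw [← smul_eq_mul]
    refine sum_le_card_nsmul _ _ _ fun c hc => le_trans (card_le_card fun i hi => ?_)
      (hA.card_col_le (hCb c hc) R)
    obtain ⟨hi, hic⟩ := mem_filter.1 hi
    exact mem_filter.2 ⟨hi, hic, h0 i hi⟩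
  rw [hRcard] at hlow
  rw [hC] at hup
  nlinarith

open Finset in
/-- Points `p` such that every `q ≤ p` sees at most `k` ones to its left in its row and at most
`k` ones before it in its column. -/
def lowerSparse {m n : ℕ} (A : Fin m → Fin n → Bool) (k : ℕ) : Set (Fin m × Fin n) :=
  {p | ∀ q ≤ p, #{j | j ≤ q.2 ∧ A q.1 j = true} ≤ k ∧ #{i | i ≤ q.1 ∧ A i q.2 = true} ≤ k}

open Finset in
/-- Points `p` such that every `q ≥ p` sees at most `k` zeros to its right in its row and at most
`k` zeros after it in its column. -/
def upperDense {m n : ℕ} (A : Fin m → Fin n → Bool) (k : ℕ) : Set (Fin m × Fin n) :=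
  {p | ∀ q, p ≤ q →
    #{j | q.2 ≤ j ∧ A q.1 j = false} ≤ k ∧ #{i | q.1 ≤ i ∧ A i q.2 = false} ≤ k}

theorem downClosed_lowerSparse {m n : ℕ} (A : Fin m → Fin n → Bool) (k : ℕ) :
    DownClosed (lowerSparse A k) :=
  fun _ _ _ _ hi hj h h' => h fun q hq => h' q (hq.trans (Prod.mk_le_mk.2 ⟨hi, hj⟩))

theorem upClosed_upperDense {m n : ℕ} (A : Fin m → Fin n → Bool) (k : ℕ) :
    UpClosed (upperDense A k) :=
  fun _ _ _ _ hi hj h q hq => h q (le_trans (Prod.mk_le_mk.2 ⟨hi, hj⟩) hq)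

open Finset in
theorem exists_of_notMem_lowerSparse {m n k : ℕ} {A : Fin m → Fin n → Bool} {p : Fin m × Fin n}
    (h : p ∉ lowerSparse A k) :
    (∃ a ≤ p.1, ∃ C : Finset (Fin n), #C = k + 1 ∧ ∀ c ∈ C, c ≤ p.2 ∧ A a c = true) ∨
    (∃ b ≤ p.2, ∃ C : Finset (Fin m), #C = k + 1 ∧ ∀ c ∈ C, c ≤ p.1 ∧ A c b = true) := by
  simp only [lowerSparse, Set.mem_ofPred_eq, not_forall, not_and_or, not_le] at h
  obtain ⟨q, hq, h | h⟩ := h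
  · obtain ⟨C, hC, hcard⟩ := exists_subset_card_eq (Nat.succ_le_of_lt h)
    refine .inl ⟨q.1, hq.1, C, hcard, fun c hc => ?_⟩
    obtain ⟨-, h1, h2⟩ := mem_filter.1 (hC hc)
    exact ⟨h1.trans hq.2, h2⟩
  · obtain ⟨C, hC, hcard⟩ := exists_subset_card_eq (Nat.succ_le_of_lt h)
    refine .inr ⟨q.2, hq.2, C, hcard, fun c hc => ?_⟩
    obtain ⟨-, h1, h2⟩ := mem_filter.1 (hC hc)
    exact ⟨h1.trans hq.1, h2⟩

open Finset in
theorem exists_of_notMem_upperDense {m n k : ℕ} {A : Fin m → Fin n → Bool} {p : Fin m × Fin n}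
    (h : p ∉ upperDense A k) :
    (∃ a ≥ p.1, ∃ D : Finset (Fin n), #D = k + 1 ∧ ∀ d ∈ D, p.2 ≤ d ∧ A a d = false) ∨
    (∃ b ≥ p.2, ∃ D : Finset (Fin m), #D = k + 1 ∧ ∀ d ∈ D, p.1 ≤ d ∧ A d b = false) := by
  simp only [upperDense, Set.mem_ofPred_eq, not_forall, not_and_or, not_le] at h
  obtain ⟨q, hq, h | h⟩ := h
  · obtain ⟨D, hD, hcard⟩ := exists_subset_card_eq (Nat.succ_le_of_lt h)
    refine .inl ⟨q.1, hq.1, D, hcard, fun d hd => ?_⟩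
    obtain ⟨-, h1, h2⟩ := mem_filter.1 (hD hd)
    exact ⟨hq.2.trans h1, h2⟩
  · obtain ⟨D, hD, hcard⟩ := exists_subset_card_eq (Nat.succ_le_of_lt h)
    refine .inr ⟨q.2, hq.2, D, hcard, fun d hd => ?_⟩
    obtain ⟨-, h1, h2⟩ := mem_filter.1 (hD hd)
    exact ⟨hq.1.trans h1, h2⟩

open Finset in
theorem TRestricted.card_diagonal_le {m n t : ℕ} {A : Fin m → Fin n → Bool}
    (hA : TRestricted t A) {c : ℤ} {S : Finset (Fin m × Fin n)}
    (hdiag : ∀ p ∈ S, ((p.2 : ℕ) : ℤ) = ((p.1 : ℕ) : ℤ) + c)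
    (hX : ∀ p ∈ S, p ∉ lowerSparse A (2 * t)) (hY : ∀ p ∈ S, p ∉ upperDense A (2 * t)) :
    #S ≤ 4 * t := by
  rcases S.eq_empty_or_nonempty with rfl | hne
  · simp
  obtain ⟨p, hp, hpmin⟩ := S.exists_min_image Prod.fst hne
  obtain ⟨q, hq, hqmax⟩ := S.exists_max_image Prod.fst hne
  have hpmin' : ∀ x ∈ S, p.2 ≤ x.2 := fun x hx => by
    have h1 := hdiag p hp
    have h2 := hdiag x hx
    have h3 := Fin.le_def.1 (hpmin x hx)
    rw [Fin.le_def]; omega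
  have hqmax' : ∀ x ∈ S, x.2 ≤ q.2 := fun x hx => by
    have h1 := hdiag q hq
    have h2 := hdiag x hx
    have h3 := Fin.le_def.1 (hqmax x hx)
    rw [Fin.le_def]; omega
  have hfst : #(S.image Prod.fst) = #S := card_image_of_injOn fun x hx y hy hxy => by
    have h1 := hdiag x hx
    have h2 := hdiag y hy
    refine Prod.ext hxy (Fin.ext ?_)
    rw [hxy] at h1; omega
  have hsnd : #(S.image Prod.snd) = #S := card_image_of_injOn fun x hx y hy hxy => by
    have h1 := hdiag x hx
    have h2 := hdiag y hy
    refine Prod.ext (Fin.ext ?_) hxy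
    rw [hxy] at h1; omega
  have hpq1 := hpmin q hq
  have hpq2 := hpmin' q hq
  rcases exists_of_notMem_lowerSparse (hX p hp) with ⟨a, ha, C, hC, h1⟩ | ⟨a, ha, C, hC, h1⟩ <;>
  rcases exists_of_notMem_upperDense (hY q hq) with ⟨b, hb, D, hD, h0⟩ | ⟨b, hb, D, hD, h0⟩
  · rw [← hfst]
    refine hA.card_rows_between_le (a := a) (a' := b) (fun i hi => ?_)
      (fun c hc d hd => ((h1 c hc).1.trans hpq2).trans (h0 d hd).1) hC hD
      (fun c hc => (h1 c hc).2) (fun d hd => (h0 d hd).2)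
    obtain ⟨x, hx, rfl⟩ := mem_image.1 hi
    exact ⟨ha.trans (hpmin x hx), (hqmax x hx).trans hb⟩
  · exact (hA.not_row_ones_col_zeros (a := a) (b := b)
      (fun i hi => (ha.trans hpq1).trans (h0 i hi).1)
      (fun c hc => ((h1 c hc).1.trans hpq2).trans hb) hC hD
      (fun c hc => (h1 c hc).2) (fun d hd => (h0 d hd).2)).elim
  · exact (hA.transpose.not_row_ones_col_zeros (a := a) (b := b)
      (fun i hi => (ha.trans hpq2).trans (h0 i hi).1)
      (fun c hc => ((h1 c hc).1.trans hpq1).trans hb) hC hD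
      (fun c hc => (h1 c hc).2) (fun d hd => (h0 d hd).2)).elim
  · rw [← hsnd]
    refine hA.transpose.card_rows_between_le (a := a) (a' := b) (fun i hi => ?_)
      (fun c hc d hd => ((h1 c hc).1.trans hpq1).trans (h0 d hd).1) hC hD
      (fun c hc => (h1 c hc).2) (fun d hd => (h0 d hd).2)
    obtain ⟨x, hx, rfl⟩ := mem_image.1 hi
    exact ⟨ha.trans (hpmin' x hx), (hqmax' x hx).trans hb⟩

/-- A set of indices in a linear order, each of which bounds fewer than `k + 1` members, has at
most `k` members. -/
theorem ncard_le_of_forall_card_filter_le {n k : ℕ} {s : Set (Fin n)} {P : Fin n → Prop}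
    [DecidablePred P] (hP : ∀ j ∈ s, P j)
    (h : ∀ j ∈ s, (Finset.univ.filter fun x => x ≤ j ∧ P x).card ≤ k) : s.ncard ≤ k := by
  rcases s.eq_empty_or_nonempty with rfl | hne
  · simp
  obtain ⟨j, hj, hmax⟩ := s.exists_max_image id s.toFinite hne
  refine le_trans ?_ (h j hj)
  rw [← Set.ncard_coe_finset]
  exact Set.ncard_le_ncard (fun x hx => by simpa using ⟨hmax x hx, hP x hx⟩) (Set.toFinite _)

theorem ncard_le_of_forall_card_filter_ge {n k : ℕ} {s : Set (Fin n)} {P : Fin n → Prop}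
    [DecidablePred P] (hP : ∀ j ∈ s, P j)
    (h : ∀ j ∈ s, (Finset.univ.filter fun x => j ≤ x ∧ P x).card ≤ k) : s.ncard ≤ k := by
  rcases s.eq_empty_or_nonempty with rfl | hne
  · simp
  obtain ⟨j, hj, hmin⟩ := s.exists_min_image id s.toFinite hne
  refine le_trans ?_ (h j hj)
  rw [← Set.ncard_coe_finset]
  exact Set.ncard_le_ncard (fun x hx => by simpa using ⟨hmin x hx, hP x hx⟩) (Set.toFinite _)

open Classical in
/-- The matrix obtained from `A` by writing zeros on `X` and ones on `Y \ X`. -/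
noncomputable def overwrite {m n : ℕ} (A : Fin m → Fin n → Bool) (X Y : Set (Fin m × Fin n)) :
    Fin m → Fin n → Bool :=
  fun i j => if (i, j) ∈ X then false else if (i, j) ∈ Y then true else A i j

theorem overwrite_of_true_of_false {m n : ℕ} {A : Fin m → Fin n → Bool}
    {X Y : Set (Fin m × Fin n)} (hX : DownClosed X) (hY : UpClosed Y) {i i' : Fin m}
    {j j' : Fin n} (hi : i ≤ i') (hj : j ≤ j') (h1 : overwrite A X Y i j = true)
    (h0 : overwrite A X Y i' j' = false) : A i j = true ∧ A i' j' = false := by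
  have hX' := hX i i' j j' hi hj
  have hY' := hY i i' j j' hi hj
  simp only [Set.mem_compl_iff] at hX'
  unfold overwrite at h1 h0
  split_ifs at h1 h0 <;> simp_all

theorem TRestricted.overwrite {m n t : ℕ} {A : Fin m → Fin n → Bool} (hA : TRestricted t A)
    {X Y : Set (Fin m × Fin n)} (hX : DownClosed X) (hY : UpClosed Y) :
    TRestricted t (overwrite A X Y) :=
  ⟨fun i i' h => (Set.ncard_le_ncard (fun _ hj =>
      overwrite_of_true_of_false hX hY h.le le_rfl hj.1 hj.2) (Set.toFinite _)).trans (hA.1 i i' h),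
    fun j j' h => (Set.ncard_le_ncard (fun _ hi =>
      overwrite_of_true_of_false hX hY le_rfl h.le hi.1 hi.2) (Set.toFinite _)).trans (hA.2 j j' h)⟩

theorem ne_overwrite {m n : ℕ} {A : Fin m → Fin n → Bool} {X Y : Set (Fin m × Fin n)}
    {i : Fin m} {j : Fin n} (h : A i j ≠ overwrite A X Y i j) :
    ((i, j) ∈ X ∧ A i j = true) ∨ ((i, j) ∈ Y ∧ A i j = false) := by
  unfold overwrite at h
  split_ifs at h <;> simp_all

theorem matLocalDiffLE_overwrite {m n : ℕ} (A : Fin m → Fin n → Bool) (k : ℕ) :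
    MatLocalDiffLE A (overwrite A (lowerSparse A k) (upperDense A k)) (k + k) := by
  refine ⟨fun i => ?_, fun j => ?_⟩
  · refine (Set.ncard_le_ncard (t := {j | (i, j) ∈ lowerSparse A k ∧ A i j = true} ∪
      {j | (i, j) ∈ upperDense A k ∧ A i j = false}) (fun j hj => ne_overwrite hj)
      (Set.toFinite _)).trans ((Set.ncard_union_le _ _).trans (add_le_add ?_ ?_))
    · exact ncard_le_of_forall_card_filter_le (P := fun j => A i j = true)
        (fun _ hj => hj.2) fun _ hj => (hj.1 _ le_rfl).1
    · exact ncard_le_of_forall_card_filter_ge (P := fun j => A i j = false)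
        (fun _ hj => hj.2) fun _ hj => (hj.1 _ le_rfl).1
  · refine (Set.ncard_le_ncard (t := {i | (i, j) ∈ lowerSparse A k ∧ A i j = true} ∪
      {i | (i, j) ∈ upperDense A k ∧ A i j = false}) (fun i hi => ne_overwrite hi)
      (Set.toFinite _)).trans ((Set.ncard_union_le _ _).trans (add_le_add ?_ ?_))
    · exact ncard_le_of_forall_card_filter_le (P := fun i => A i j = true)
        (fun _ hi => hi.2) fun _ hi => (hi.1 _ le_rfl).2
    · exact ncard_le_of_forall_card_filter_ge (P := fun i => A i j = false)
        (fun _ hi => hi.2) fun _ hi => (hi.1 _ le_rfl).2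

theorem union_subset_maxClosedIn_overwrite {m n : ℕ} (A : Fin m → Fin n → Bool)
    {X Y : Set (Fin m × Fin n)} (hX : DownClosed X) (hY : UpClosed Y) :
    X ∪ Y ⊆ maxDownClosedIn {q : Fin m × Fin n | overwrite A X Y q.1 q.2 = false} ∪
      maxUpClosedIn {q : Fin m × Fin n | overwrite A X Y q.1 q.2 = true} := by
  intro p hp
  by_cases hpX : p ∈ X
  · exact .inl ⟨X, ⟨hX, fun q hq => by simp [overwrite, hq]⟩, hpX⟩
  · refine .inr ⟨Y \ X, ⟨fun i i' j j' hi hj h => ?_, fun q hq => ?_⟩,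
      hp.resolve_left hpX, hpX⟩
    · exact ⟨hY i i' j j' hi hj h.1, hX i i' j j' hi hj h.2⟩
    · simp [overwrite, hq.1, hq.2]

theorem statement_11 {m n : ℕ} (t : ℕ) (A : Fin m → Fin n → Bool)
    (hA : TRestricted t A) :
    ∃ B : Fin m → Fin n → Bool,
      TRestricted t B ∧ BreadthLE B (4 * t) ∧ MatLocalDiffLE A B (4 * t) := by
  have hX := downClosed_lowerSparse A (2 * t)
  have hY := upClosed_upperDense A (2 * t)
  refine ⟨overwrite A (lowerSparse A (2 * t)) (upperDense A (2 * t)), hA.overwrite hX hY,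
    fun c => ?_, ?_⟩
  · rw [Set.ncard_eq_toFinset_card _ (Set.toFinite _)]
    refine hA.card_diagonal_le (c := c) (fun p hp => ?_) (fun p hp => ?_) (fun p hp => ?_) <;>
      rw [Set.Finite.mem_toFinset] at hp
    · exact hp.1
    · exact fun h => hp.2 (union_subset_maxClosedIn_overwrite A hX hY (.inl h))
    · exact fun h => hp.2 (union_subset_maxClosedIn_overwrite A hX hY (.inr h))
  · have := matLocalDiffLE_overwrite A (2 * t)
    rwa [show 2 * t + 2 * t = 4 * t by ring] at this
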